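/- arXiv:math/0011020 — 2 statements merged into one kernel-verified Lean document; each statement's English description precedes it below -/
import Mathlib

section
/- (Freeness of the fiber subalgebra.) For every n ≥ 2, the Lie algebra homomorphism from the free Lie algebra over ℚ on n-1 generators a_1, …, a_{n-1} to B_n determined by a_i ↦ x_{in} is injective; in particular, the Lie subalgebra of B_n generated by x_{1n}, …, x_{n-1,n} is a free Lie algebra on those n-1 elements. -/
noncomputable section

open FreeLieAlgebra

/-- The defining relations of the braid Lie algebra `B_n`, as elements of the free Lie
algebra over `ℚ` on the symbols `x_{ij}`, `1 ≤ i, j ≤ n` (here 0-indexed by `Fin n × Fin n`):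
(1) `x_{ij} = x_{ji}`; (2) `x_{ii} = 0`; (3) `[x_{ij}, x_{lm}] = 0` when `{i,j} ∩ {l,m} = ∅`;
(4) `[x_{ij}, x_{jl}] = [x_{jl}, x_{li}] = [x_{li}, x_{ij}]` for distinct `i, j, l`. -/
def braidRel (n : ℕ) : Set (FreeLieAlgebra ℚ (Fin n × Fin n)) :=
  {a | (∃ i j : Fin n, a = of ℚ (i, j) - of ℚ (j, i)) ∨
       (∃ i : Fin n, a = of ℚ (i, i)) ∨
       (∃ i j l m : Fin n, ({i, j} ∩ {l, m} : Set (Fin n)) = ∅ ∧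
          a = ⁅of ℚ (i, j), of ℚ (l, m)⁆) ∨
       (∃ i j l : Fin n, i ≠ j ∧ j ≠ l ∧ i ≠ l ∧
          (a = ⁅of ℚ (i, j), of ℚ (j, l)⁆ - ⁅of ℚ (j, l), of ℚ (l, i)⁆ ∨
           a = ⁅of ℚ (j, l), of ℚ (l, i)⁆ - ⁅of ℚ (l, i), of ℚ (i, j)⁆))}

/-- The Lie ideal generated by the braid relations. -/
def braidIdeal (n : ℕ) : LieIdeal ℚ (FreeLieAlgebra ℚ (Fin n × Fin n)) :=
  LieSubmodule.lieSpan ℚ _ (braidRel n)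

/-- The braid Lie algebra `B_n`: the quotient of the free Lie algebra over `ℚ` on the
symbols `x_{ij}`, `1 ≤ i, j ≤ n`, by the Lie ideal generated by the braid relations. -/
abbrev BraidLie (n : ℕ) : Type :=
  FreeLieAlgebra ℚ (Fin n × Fin n) ⧸ braidIdeal n

/-- The class of the generator `x_{ij}` in `B_n`, for `1 ≤ i, j ≤ n`
(junk value `0` out of range). -/
def xgen (n i j : ℕ) : BraidLie n :=
  if h : 1 ≤ i ∧ i ≤ n ∧ 1 ≤ j ∧ j ≤ n then
    LieSubmodule.Quotient.mk' (braidIdeal n)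
      (of ℚ (⟨i - 1, by omega⟩, ⟨j - 1, by omega⟩))
  else 0

namespace FreeLieAlgebra

variable {R X M : Type*} [CommRing R] [AddCommGroup M] [Module R M]
  [LieRingModule (FreeLieAlgebra R X) M] [LieModule R (FreeLieAlgebra R X) M]

theorem lieSpan_range_of :
    LieSubalgebra.lieSpan R (FreeLieAlgebra R X) (Set.range (of R)) = ⊤ := by
  let S := LieSubalgebra.lieSpan R (FreeLieAlgebra R X) (Set.range (of R))
  let φ : FreeLieAlgebra R X →ₗ⁅R⁆ S :=
    lift R fun x => ⟨of R x, LieSubalgebra.subset_lieSpan ⟨x, rfl⟩⟩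
  have h : S.incl.comp φ = LieHom.id := by
    ext x
    simp [φ]
  refine eq_top_iff.2 fun x _ => ?_
  have hx : (φ x : FreeLieAlgebra R X) = x := LieHom.congr_fun h x
  exact hx ▸ (φ x).2

/-- A derivation of a free Lie algebra is determined by its values on the generators. -/
theorem derivation_ext {D₁ D₂ : LieDerivation R (FreeLieAlgebra R X) M}
    (h : ∀ x, D₁ (of R x) = D₂ (of R x)) : D₁ = D₂ :=
  LieDerivation.ext_of_lieSpan_eq_top _ lieSpan_range_of (by rintro _ ⟨x, rfl⟩; exact h x)

/-- The homomorphism to the split square-zero extension by `M` induced by a map `X → M`. -/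
def toSquareZero (f : X → M) : FreeLieAlgebra R X →ₗ⁅R⁆
    LieAlgebra.ofTwoCocycle (0 : LieModule.Cohomology.twoCocycle R (FreeLieAlgebra R X) M) :=
  lift R fun x => LieAlgebra.ofProd _ (of R x, f x)

theorem toSquareZero_fst (f : X → M) (a : FreeLieAlgebra R X) :
    ((LieAlgebra.ofProd _).symm (toSquareZero f a)).1 = a := by
  let p : LieAlgebra.ofTwoCocycle
      (0 : LieModule.Cohomology.twoCocycle R (FreeLieAlgebra R X) M) →ₗ⁅R⁆ FreeLieAlgebra R X :=
    { toFun x := ((LieAlgebra.ofProd _).symm x).1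
      map_add' _ _ := by simp
      map_smul' _ _ := by simp
      map_lie' {_ _} := by simp [LieAlgebra.bracket_ofTwoCocycle] }
  have h : p.comp (toSquareZero f) = LieHom.id := by
    ext x
    simp only [LieHom.comp_apply, toSquareZero, lift_of_apply, LieHom.id_apply]
    rfl
  exact LieHom.congr_fun h a

/-- The derivation of a free Lie algebra with prescribed values on the generators. -/
def derivation (f : X → M) : LieDerivation R (FreeLieAlgebra R X) M where
  toFun a := ((LieAlgebra.ofProd _).symm (toSquareZero f a)).2
  map_add' _ _ := by simp
  map_smul' _ _ := by simp
  leibniz' a b := by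
    simp [LieAlgebra.bracket_ofTwoCocycle, toSquareZero_fst]

@[simp]
theorem derivation_of (f : X → M) (x : X) : derivation f (of R x) = f x := by
  change ((LieAlgebra.ofProd _).symm (toSquareZero f (of R x))).2 = f x
  simp [toSquareZero]

end FreeLieAlgebra

section BraidAction

variable {m : ℕ}

/-- The derivation of the free Lie algebra on `a_1, …, a_m` sending `a_i` to `[a_i, a_j]`,
`a_j` to `[a_j, a_i]` and every other generator to `0`. -/
def braidDerivation (i j : Fin m) :
    LieDerivation ℚ (FreeLieAlgebra ℚ (Fin m)) (FreeLieAlgebra ℚ (Fin m)) :=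
  derivation fun k =>
    ⁅of ℚ k, (if k = i then of ℚ j else 0) + (if k = j then of ℚ i else 0)⁆

@[simp]
theorem braidDerivation_of (i j k : Fin m) :
    braidDerivation i j (of ℚ k) =
      ⁅of ℚ k, (if k = i then of ℚ j else 0) + (if k = j then of ℚ i else 0)⁆ :=
  derivation_of _ _

theorem braidDerivation_comm (i j : Fin m) : braidDerivation i j = braidDerivation j i :=
  derivation_ext fun k => by simp [add_comm]

theorem braidDerivation_self (i : Fin m) : braidDerivation i i = 0 :=
  derivation_ext fun k => by
    rw [braidDerivation_of]
    split_ifs with h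
    · simp [h]
    · simp

theorem lie_braidDerivation_of_disjoint {i j k l : Fin m} (hik : i ≠ k) (hil : i ≠ l)
    (hjk : j ≠ k) (hjl : j ≠ l) : ⁅braidDerivation i j, braidDerivation k l⁆ = 0 :=
  derivation_ext fun t => by
    by_cases h1 : t = i <;> by_cases h2 : t = j <;> by_cases h3 : t = k <;>
      by_cases h4 : t = l <;> subst_vars <;> simp_all [eq_comm]

theorem lie_braidDerivation_cyclic {i j l : Fin m} (hij : i ≠ j) (hjl : j ≠ l) (hil : i ≠ l) :
    ⁅braidDerivation i j, braidDerivation j l⁆ = ⁅braidDerivation j l, braidDerivation l i⁆ :=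
  derivation_ext fun t => by
    have hji := hij.symm
    have hlj := hjl.symm
    have hli := hil.symm
    by_cases h1 : t = i
    · subst h1
      simp [*]
      grind [lie_jacobi (of ℚ t) (of ℚ j) (of ℚ l), lie_skew, lie_neg]
    by_cases h2 : t = j
    · subst h2
      simp [*]
      grind [lie_jacobi (of ℚ t) (of ℚ i) (of ℚ l), lie_skew, lie_neg]
    by_cases h3 : t = l
    · subst h3
      simp [*]
      grind [lie_jacobi (of ℚ t) (of ℚ i) (of ℚ j), lie_skew, lie_neg]
    simp [*]

/-- The semidirect sum of the free Lie algebra on `m` generators with its derivations. -/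
abbrev FreeHolomorph (m : ℕ) : Type :=
  LieAlgebra.SemiDirectSum (R := ℚ) (FreeLieAlgebra ℚ (Fin m))
    (LieDerivation ℚ (FreeLieAlgebra ℚ (Fin m)) (FreeLieAlgebra ℚ (Fin m))) LieHom.id

/-- The images of the generators of the braid Lie algebra on `m + 1` strands: `x_{ij}` acts by
`braidDerivation i j`, and `x_{i,m+1}` is the generator `a_i`. -/
def braidImage (i j : Fin (m + 1)) : FreeHolomorph m :=
  Fin.lastCases (motive := fun _ => FreeHolomorph m)
    (Fin.lastCases (motive := fun _ => FreeHolomorph m) ⟨0, 0⟩ (fun j' => ⟨of ℚ j', 0⟩) j)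
    (fun i' => Fin.lastCases (motive := fun _ => FreeHolomorph m) ⟨of ℚ i', 0⟩
      (fun j' => ⟨0, braidDerivation i' j'⟩) j) i

@[simp]
theorem braidImage_last_last : braidImage (Fin.last m) (Fin.last m) = ⟨0, 0⟩ := by
  simp [braidImage]

@[simp]
theorem braidImage_last_castSucc (j : Fin m) :
    braidImage (Fin.last m) j.castSucc = ⟨of ℚ j, 0⟩ := by
  simp [braidImage]

@[simp]
theorem braidImage_castSucc_last (i : Fin m) :
    braidImage i.castSucc (Fin.last m) = ⟨of ℚ i, 0⟩ := by
  simp [braidImage]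

@[simp]
theorem braidImage_castSucc_castSucc (i j : Fin m) :
    braidImage i.castSucc j.castSucc = ⟨0, braidDerivation i j⟩ := by
  simp [braidImage]

theorem braidImage_comm (i j : Fin (m + 1)) : braidImage i j = braidImage j i := by
  induction i using Fin.lastCases <;> induction j using Fin.lastCases <;>
    simp [braidDerivation_comm]

theorem braidImage_self (i : Fin (m + 1)) : braidImage i i = 0 := by
  induction i using Fin.lastCases <;> simp [braidDerivation_self]

theorem lie_braidImage_of_disjoint {i j k l : Fin (m + 1)} (hik : i ≠ k) (hil : i ≠ l)
    (hjk : j ≠ k) (hjl : j ≠ l) : ⁅braidImage i j, braidImage k l⁆ = 0 := by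
  induction i using Fin.lastCases <;> induction j using Fin.lastCases <;>
    induction k using Fin.lastCases <;> induction l using Fin.lastCases <;>
    simp_all [eq_comm, lie_braidDerivation_of_disjoint]

theorem lie_braidImage_cyclic {i j l : Fin (m + 1)} (hij : i ≠ j) (hjl : j ≠ l) (hil : i ≠ l) :
    ⁅braidImage i j, braidImage j l⁆ = ⁅braidImage j l, braidImage l i⁆ := by
  have hji := hij.symm
  have hlj := hjl.symm
  have hli := hil.symm
  induction i using Fin.lastCases <;> induction j using Fin.lastCases <;>
    induction l using Fin.lastCases <;>
    simp_all
  exact lie_braidDerivation_cyclic hij hjl hil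

/-- The homomorphism from the free Lie algebra on the symbols `x_{ij}` given by `braidImage`. -/
def braidHom (m : ℕ) : FreeLieAlgebra ℚ (Fin (m + 1) × Fin (m + 1)) →ₗ⁅ℚ⁆ FreeHolomorph m :=
  lift ℚ fun p => braidImage p.1 p.2

theorem braidIdeal_le_ker_braidHom : braidIdeal (m + 1) ≤ (braidHom m).ker := by
  refine LieSubmodule.lieSpan_le.2 ?_
  rintro a (⟨i, j, rfl⟩ | ⟨i, rfl⟩ | ⟨i, j, k, l, h, rfl⟩ | ⟨i, j, l, hij, hjl, hil, rfl | rfl⟩) <;>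
    simp only [SetLike.mem_coe, LieHom.mem_ker, braidHom, LieHom.map_lie, map_sub, lift_of_apply]
  · exact sub_eq_zero.2 (braidImage_comm i j)
  · exact braidImage_self i
  · have hne : ∀ x ∈ ({i, j} : Set (Fin (m + 1))), ∀ y ∈ ({k, l} : Set (Fin (m + 1))), x ≠ y :=
      Set.disjoint_iff_forall_ne.1 (Set.disjoint_iff_inter_eq_empty.2 h)
    exact lie_braidImage_of_disjoint (hne _ (by simp) _ (by simp)) (hne _ (by simp) _ (by simp))
      (hne _ (by simp) _ (by simp)) (hne _ (by simp) _ (by simp))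
  · exact sub_eq_zero.2 (lie_braidImage_cyclic hij hjl hil)
  · exact sub_eq_zero.2 (lie_braidImage_cyclic hjl hil.symm hij.symm)

/-- The projection to the braid Lie algebra, as a homomorphism of Lie algebras. -/
def braidMk (n : ℕ) : FreeLieAlgebra ℚ (Fin n × Fin n) →ₗ⁅ℚ⁆ BraidLie n where
  toLinearMap := (LieSubmodule.Quotient.mk' (braidIdeal n) : _ →ₗ[ℚ] _)
  map_lie' {x y} := LieSubmodule.Quotient.mk_bracket _ x y

end BraidAction

/-- Freeness of the fiber subalgebra: for `n ≥ 2`, the Lie algebra homomorphism from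
the free Lie algebra over `ℚ` on `n - 1` generators to `B_n` sending the `i`-th
generator `a_i` to `x_{in}` is injective; in particular the Lie subalgebra of `B_n`
generated by `x_{1n}, …, x_{n-1,n}` is free on those elements. -/
theorem free_fiber_subalgebra (n : ℕ) (hn : 2 ≤ n) :
    Function.Injective
      (FreeLieAlgebra.lift ℚ (fun i : Fin (n - 1) => xgen n (i.val + 1) n)) := by
  obtain ⟨m, rfl⟩ : ∃ m, n = m + 1 := ⟨n - 1, by omega⟩
  let σ : FreeLieAlgebra ℚ (Fin m) →ₗ⁅ℚ⁆ FreeLieAlgebra ℚ (Fin (m + 1) × Fin (m + 1)) :=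
    lift ℚ fun i => of ℚ (i.castSucc, Fin.last m)
  have hσ : lift ℚ (fun i : Fin m => xgen (m + 1) (i.val + 1) (m + 1)) =
      (braidMk (m + 1)).comp σ := by
    ext i
    have hi : i.val ≤ m := i.is_lt.le
    simp only [lift_of_apply, LieHom.comp_apply, σ]
    rw [xgen, dif_pos (by omega)]
    rfl
  have hinl : (braidHom m).comp σ = LieAlgebra.SemiDirectSum.inl LieHom.id := by
    ext i : 1
    simp [σ, braidHom]
  change Function.Injective (lift ℚ fun i : Fin m => xgen (m + 1) (i.val + 1) (m + 1))
  rw [hσ, injective_iff_map_eq_zero]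
  intro x hx
  have hmem : σ x ∈ braidIdeal (m + 1) := (LieSubmodule.Quotient.mk_eq_zero _).1 hx
  have hx0 : braidHom m (σ x) = 0 := LieHom.mem_ker.1 (braidIdeal_le_ker_braidHom hmem)
  have hx1 := (LieHom.congr_fun hinl x).symm.trans hx0
  exact LieAlgebra.SemiDirectSum.inl_injective _ (hx1.trans (map_zero _).symm)

end
end

section
/- In the braid Lie algebra B_4, with d^1 = ∂^0 - ∂^1 + ∂^2 - ∂^3 + ∂^4 : B_3 → B_4 the alternating sum of the coface maps, one has d^1([x_{13}, [x_{13}, x_{23}]]) = 0. -/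
noncomputable section

open FreeLieAlgebra

/-- `σ^ℓ(i) = i` if `i < ℓ` and `i + 1` if `i > ℓ`. -/
def sigmaMap (ℓ i : ℕ) : ℕ := if i < ℓ then i else i + 1

/-- `F : B_n → B_{n+1}` is the coface map `∂^ℓ` if `F(x_{ij}) = x_{σ^ℓ(i) σ^ℓ(j)}` for
`i, j ≠ ℓ` and `F(x_{ℓ j}) = x_{ℓ, σ^ℓ(j)} + x_{ℓ+1, σ^ℓ(j)}` for `j ≠ ℓ`. -/
def IsCoface (n ℓ : ℕ) (F : BraidLie n →ₗ⁅ℚ⁆ BraidLie (n + 1)) : Prop :=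
  (∀ i j : ℕ, 1 ≤ i → i ≤ n → 1 ≤ j → j ≤ n → i ≠ ℓ → j ≠ ℓ →
      F (xgen n i j) = xgen (n + 1) (sigmaMap ℓ i) (sigmaMap ℓ j)) ∧
  (1 ≤ ℓ → ℓ ≤ n → ∀ j : ℕ, 1 ≤ j → j ≤ n → j ≠ ℓ →
      F (xgen n ℓ j) = xgen (n + 1) ℓ (sigmaMap ℓ j) + xgen (n + 1) (ℓ + 1) (sigmaMap ℓ j))

theorem mk_eq_zero_of_braidRel {n : ℕ} {a : FreeLieAlgebra ℚ (Fin n × Fin n)}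
    (h : a ∈ braidRel n) : LieSubmodule.Quotient.mk' (braidIdeal n) a = 0 :=
  (LieSubmodule.Quotient.mk_eq_zero' (N := braidIdeal n)).2 (LieSubmodule.subset_lieSpan h)

theorem xgen_add_one (n : ℕ) (i j : Fin n) :
    xgen n (i + 1) (j + 1) = LieSubmodule.Quotient.mk' (braidIdeal n) (of ℚ (i, j)) :=
  dif_pos (by omega)

theorem mk_lie {n : ℕ} (a b : FreeLieAlgebra ℚ (Fin n × Fin n)) :
    LieSubmodule.Quotient.mk' (braidIdeal n) ⁅a, b⁆ =
      (⁅LieSubmodule.Quotient.mk' (braidIdeal n) a,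
        LieSubmodule.Quotient.mk' (braidIdeal n) b⁆ : BraidLie n) :=
  rfl

theorem xgen_symm (n : ℕ) (i j : Fin n) : xgen n (i + 1) (j + 1) = xgen n (j + 1) (i + 1) := by
  rw [xgen_add_one, xgen_add_one, ← sub_eq_zero, ← map_sub]
  exact mk_eq_zero_of_braidRel (Or.inl ⟨i, j, rfl⟩)

theorem xgen_lie_eq_zero (n : ℕ) (i j l m : Fin n)
    (h : ({i, j} ∩ {l, m} : Set (Fin n)) = ∅) :
    ⁅xgen n (i + 1) (j + 1), xgen n (l + 1) (m + 1)⁆ = 0 := by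
  rw [xgen_add_one, xgen_add_one, ← mk_lie]
  exact mk_eq_zero_of_braidRel (Or.inr (Or.inr (Or.inl ⟨i, j, l, m, h, rfl⟩)))

theorem xgen_lie_cyclic (n : ℕ) (i j l : Fin n) (hij : i ≠ j) (hjl : j ≠ l) (hil : i ≠ l) :
    ⁅xgen n (i + 1) (j + 1), xgen n (j + 1) (l + 1)⁆ =
      ⁅xgen n (j + 1) (l + 1), xgen n (l + 1) (i + 1)⁆ := by
  rw [xgen_add_one, xgen_add_one, xgen_add_one, ← sub_eq_zero, ← mk_lie, ← mk_lie, ← map_sub]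
  exact mk_eq_zero_of_braidRel
    (Or.inr (Or.inr (Or.inr ⟨i, j, l, hij, hjl, hil, Or.inl rfl⟩)))

theorem alternating_sum_lie_eq_zero {L : Type*} [LieRing L] {p q a b c : L}
    (hpb : ⁅p, b⁆ = 0) (haq : ⁅a, q⁆ = 0) (hpa : ⁅p, a⁆ = ⁅a, c⁆) (hcq : ⁅c, q⁆ = ⁅b, c⁆) :
    ⁅b, ⁅b, c⁆⁆ - ⁅a + b, ⁅a + b, c⁆⁆ + ⁅a, ⁅a, b + c⁆⁆ - ⁅p + a, ⁅p + a, q + b⁆⁆ + ⁅p, ⁅p, q⁆⁆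
      = 0 := by
  have hpab : ⁅p, ⁅a, b⁆⁆ = -⁅b, ⁅a, c⁆⁆ := by
    rw [leibniz_lie, hpa, hpb, lie_zero, add_zero, lie_skew]
  have hapq : ⁅a, ⁅p, q⁆⁆ = -⁅a, ⁅b, c⁆⁆ := by
    rw [leibniz_lie, haq, lie_zero, add_zero, ← lie_skew a p, hpa, neg_lie, lie_lie, haq, hcq,
      lie_zero, sub_zero]
  simp only [lie_add, add_lie, hpb, haq, lie_zero, hpab, hapq]
  abel

/-- With `d^1 = ∂^0 - ∂^1 + ∂^2 - ∂^3 + ∂^4 : B_3 → B_4` the alternating sum of the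
coface maps, one has `d^1([x_{13}, [x_{13}, x_{23}]]) = 0`. -/
theorem d1_first_basis_element (D0 D1 D2 D3 D4 : BraidLie 3 →ₗ⁅ℚ⁆ BraidLie 4)
    (h0 : IsCoface 3 0 D0) (h1 : IsCoface 3 1 D1) (h2 : IsCoface 3 2 D2)
    (h3 : IsCoface 3 3 D3) (h4 : IsCoface 3 4 D4) :
    D0 ⁅xgen 3 1 3, ⁅xgen 3 1 3, xgen 3 2 3⁆⁆
      - D1 ⁅xgen 3 1 3, ⁅xgen 3 1 3, xgen 3 2 3⁆⁆
      + D2 ⁅xgen 3 1 3, ⁅xgen 3 1 3, xgen 3 2 3⁆⁆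
      - D3 ⁅xgen 3 1 3, ⁅xgen 3 1 3, xgen 3 2 3⁆⁆
      + D4 ⁅xgen 3 1 3, ⁅xgen 3 1 3, xgen 3 2 3⁆⁆ = 0 := by
  have s13 : xgen 3 1 3 = xgen 3 3 1 := xgen_symm 3 0 2
  have s23 : xgen 3 2 3 = xgen 3 3 2 := xgen_symm 3 1 2
  have s31 : xgen 4 3 1 = xgen 4 1 3 := xgen_symm 4 2 0
  have s41 : xgen 4 4 1 = xgen 4 1 4 := xgen_symm 4 3 0
  have s32 : xgen 4 3 2 = xgen 4 2 3 := xgen_symm 4 2 1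
  have s42 : xgen 4 4 2 = xgen 4 2 4 := xgen_symm 4 3 1
  have s43 : xgen 4 4 3 = xgen 4 3 4 := xgen_symm 4 3 2
  have e0 : D0 (xgen 3 1 3) = xgen 4 2 4 :=
    h0.1 1 3 (by simp) (by simp) (by simp) (by simp) (by simp) (by simp)
  have f0 : D0 (xgen 3 2 3) = xgen 4 3 4 :=
    h0.1 2 3 (by simp) (by simp) (by simp) (by simp) (by simp) (by simp)
  have e1 : D1 (xgen 3 1 3) = xgen 4 1 4 + xgen 4 2 4 :=
    h1.2 (by simp) (by simp) 3 (by simp) (by simp) (by simp)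
  have f1 : D1 (xgen 3 2 3) = xgen 4 3 4 :=
    h1.1 2 3 (by simp) (by simp) (by simp) (by simp) (by simp) (by simp)
  have e2 : D2 (xgen 3 1 3) = xgen 4 1 4 :=
    h2.1 1 3 (by simp) (by simp) (by simp) (by simp) (by simp) (by simp)
  have f2 : D2 (xgen 3 2 3) = xgen 4 2 4 + xgen 4 3 4 :=
    h2.2 (by simp) (by simp) 3 (by simp) (by simp) (by simp)
  have e3 : D3 (xgen 3 1 3) = xgen 4 1 3 + xgen 4 1 4 := by
    rw [s13, ← s31, ← s41]
    exact h3.2 (by simp) (by simp) 1 (by simp) (by simp) (by simp)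
  have f3 : D3 (xgen 3 2 3) = xgen 4 2 3 + xgen 4 2 4 := by
    rw [s23, ← s32, ← s42]
    exact h3.2 (by simp) (by simp) 2 (by simp) (by simp) (by simp)
  have e4 : D4 (xgen 3 1 3) = xgen 4 1 3 :=
    h4.1 1 3 (by simp) (by simp) (by simp) (by simp) (by simp) (by simp)
  have f4 : D4 (xgen 3 2 3) = xgen 4 2 3 :=
    h4.1 2 3 (by simp) (by simp) (by simp) (by simp) (by simp) (by simp)
  have hpb : ⁅xgen 4 1 3, xgen 4 2 4⁆ = 0 :=
    xgen_lie_eq_zero 4 0 2 1 3 (by ext x; fin_cases x <;> simp)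
  have haq : ⁅xgen 4 1 4, xgen 4 2 3⁆ = 0 :=
    xgen_lie_eq_zero 4 0 3 1 2 (by ext x; fin_cases x <;> simp)
  have hpa : ⁅xgen 4 1 3, xgen 4 1 4⁆ = ⁅xgen 4 1 4, xgen 4 3 4⁆ := by
    have h : ⁅xgen 4 3 1, xgen 4 1 4⁆ = ⁅xgen 4 1 4, xgen 4 4 3⁆ :=
      xgen_lie_cyclic 4 2 0 3 (by decide) (by decide) (by decide)
    rwa [s31, s43] at h
  have hcq : ⁅xgen 4 3 4, xgen 4 2 3⁆ = ⁅xgen 4 2 4, xgen 4 3 4⁆ := by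
    have h : ⁅xgen 4 2 4, xgen 4 4 3⁆ = ⁅xgen 4 4 3, xgen 4 3 2⁆ :=
      xgen_lie_cyclic 4 1 3 2 (by decide) (by decide) (by decide)
    rw [s43, s32] at h
    exact h.symm
  simp only [LieHom.map_lie, e0, f0, e1, f1, e2, f2, e3, f3, e4, f4]
  exact alternating_sum_lie_eq_zero hpb haq hpa hcq

end
end
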